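/- arXiv:2508.17048 — 3 statements merged into one kernel-verified Lean document; each statement's English description precedes it below -/
import Mathlib

section
/- Let f : V → W be any morphism of finite-dimensional complex representations of a group π. If both V and W admit filtrations by subrepresentations with all successive quotients of finite image, then ker(f), im(f), and coker(f) all admit such filtrations; in particular the full subcategory of such representations is closed under kernels, images and cokernels. -/
open scoped TensorProduct

section Defs

variable {π : Type} [Group π] {V W : Type}
  [AddCommGroup V] [Module ℂ V] [AddCommGroup W] [Module ℂ W]

/-- `p` is a subrepresentation of `ρ`. -/
def IsSubrep (ρ : Representation ℂ π V) (p : Submodule ℂ V) : Prop :=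
  ∀ g : π, ∀ x ∈ p, ρ g x ∈ p

/-- Restriction of a representation to an invariant submodule. -/
def subRep (ρ : Representation ℂ π V) (p : Submodule ℂ V) (hp : IsSubrep ρ p) :
    Representation ℂ π p where
  toFun g := (ρ g).restrict (fun x hx => hp g x hx)
  map_one' := by ext x; simp [LinearMap.restrict_apply]
  map_mul' g h := by ext x; simp [LinearMap.restrict_apply]

/-- Quotient representation on `V ⧸ p`. -/
def quotRep (ρ : Representation ℂ π V) (p : Submodule ℂ V) (hp : IsSubrep ρ p) :
    Representation ℂ π (V ⧸ p) where
  toFun g := p.mapQ p (ρ g) (fun x hx => hp g x hx)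
  map_one' := by apply Submodule.linearMap_qext; ext x; simp [Submodule.mapQ_apply]
  map_mul' g h := by apply Submodule.linearMap_qext; ext x; simp [Submodule.mapQ_apply]

/-- Graded piece `p ⧸ q` for a filtration step `q ≤ p`. -/
def gradedRep (ρ : Representation ℂ π V) (p q : Submodule ℂ V)
    (hp : IsSubrep ρ p) (hq : IsSubrep ρ q) :
    Representation ℂ π (↥p ⧸ (q.comap p.subtype)) :=
  quotRep (subRep ρ p hp) (q.comap p.subtype)
    (fun g x hx => by
      simpa [subRep, Submodule.mem_comap, LinearMap.restrict_apply] using hq g x hx)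

/-- A representation has finite image. -/
def HasFiniteImage (ρ : Representation ℂ π V) : Prop := (Set.range ρ).Finite

/-- A representation is semi-finite: it admits a filtration by subrepresentations
whose successive quotients have finite image. -/
def SemiFinite (ρ : Representation ℂ π V) : Prop :=
  ∃ (n : ℕ) (F : Fin (n + 2) → Submodule ℂ V) (hF : ∀ i, IsSubrep ρ (F i)),
    F 0 = ⊤ ∧ F (Fin.last (n + 1)) = ⊥ ∧
    (∀ i : Fin (n + 1), F i.succ ≤ F i.castSucc) ∧
    ∀ i : Fin (n + 1),
      HasFiniteImage (gradedRep ρ (F i.castSucc) (F i.succ) (hF _) (hF _))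

/-- External direct sum of two representations. -/
def prodRep (ρ : Representation ℂ π V) (σ : Representation ℂ π W) :
    Representation ℂ π (V × W) where
  toFun g := (ρ g).prodMap (σ g)
  map_one' := by ext x <;> simp
  map_mul' g h := by ext x <;> simp

end Defs

section Helpers

variable {π : Type} [Group π] {V W : Type}
  [AddCommGroup V] [Module ℂ V] [AddCommGroup W] [Module ℂ W]

theorem gradedRep_eq_iff (ρ : Representation ℂ π V) (p q : Submodule ℂ V)
    (hp : IsSubrep ρ p) (hq : IsSubrep ρ q) (g h : π) :
    gradedRep ρ p q hp hq g = gradedRep ρ p q hp hq h ↔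
      ∀ x ∈ p, ρ g x - ρ h x ∈ q := by
  constructor
  · intro H x hx
    have := LinearMap.congr_fun H (Submodule.Quotient.mk ⟨x, hx⟩)
    exact (Submodule.Quotient.eq (q.comap p.subtype)).1 this
  · intro H
    apply Submodule.linearMap_qext
    ext x
    exact (Submodule.Quotient.eq _).2 (H x x.2)

theorem finite_range_of_imp {α β γ : Type*} (a : α → β) (b : α → γ)
    (hab : ∀ x y, a x = a y → b x = b y) (ha : (Set.range a).Finite) :
    (Set.range b).Finite := by
  classical
  by_cases hα : Nonempty α
  · have : Set.range b ⊆ (fun y => b (Function.invFun a y)) '' Set.range a := by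
      rintro _ ⟨x, rfl⟩
      exact ⟨a x, ⟨x, rfl⟩, hab _ _ (Function.invFun_eq ⟨x, rfl⟩)⟩
    exact (ha.image _).subset this
  · have := not_nonempty_iff.1 hα
    rw [Set.range_eq_empty]
    exact Set.finite_empty

theorem SemiFinite.of_injective {ρ : Representation ℂ π V} {σ : Representation ℂ π W}
    (i : V →ₗ[ℂ] W) (hi : ∀ (g : π) (x : V), i (ρ g x) = σ g (i x))
    (inj : Function.Injective i) (hW : SemiFinite σ) : SemiFinite ρ := by
  obtain ⟨n, F, hF, h0, h1, hle, hfin⟩ := hW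
  refine ⟨n, fun j => (F j).comap i, fun j g x hx => ?_, ?_, ?_, fun j => ?_, fun j => ?_⟩
  · rw [Submodule.mem_comap, hi]
    exact hF j g _ hx
  · simp [h0]
  · simpa [h1] using LinearMap.ker_eq_bot.2 inj
  · exact Submodule.comap_mono (hle j)
  · refine finite_range_of_imp _ _ (fun g h H => ?_) (hfin j)
    rw [gradedRep_eq_iff] at H ⊢
    intro x hx
    rw [Submodule.mem_comap, map_sub, hi, hi]
    exact H _ hx

theorem SemiFinite.of_surjective {ρ : Representation ℂ π V} {σ : Representation ℂ π W}
    (s : V →ₗ[ℂ] W) (hs : ∀ (g : π) (x : V), s (ρ g x) = σ g (s x))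
    (surj : Function.Surjective s) (hV : SemiFinite ρ) : SemiFinite σ := by
  obtain ⟨n, F, hF, h0, h1, hle, hfin⟩ := hV
  refine ⟨n, fun j => (F j).map s, fun j g x hx => ?_, ?_, ?_, fun j => ?_, fun j => ?_⟩
  · obtain ⟨y, hy, rfl⟩ := hx
    exact ⟨ρ g y, hF j g _ hy, hs g y⟩
  · simpa [h0] using LinearMap.range_eq_top.2 surj
  · simp [h1]
  · exact Submodule.map_mono (hle j)
  · refine finite_range_of_imp _ _ (fun g h H => ?_) (hfin j)
    rw [gradedRep_eq_iff] at H ⊢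
    rintro _ ⟨x, hx, rfl⟩
    exact ⟨_, H x hx, by rw [map_sub, hs, hs]⟩

end Helpers

/-- For a morphism `f : V → W` of semi-finite representations, the kernel,
image and cokernel are again semi-finite; so the category of semi-finite representations
is closed under kernels, images and cokernels. -/
theorem stmt_4 {π V W : Type} [Group π] [AddCommGroup V] [Module ℂ V]
    [AddCommGroup W] [Module ℂ W] [FiniteDimensional ℂ V] [FiniteDimensional ℂ W]
    (ρ : Representation ℂ π V) (σ : Representation ℂ π W)
    (f : V →ₗ[ℂ] W) (hf : ∀ (g : π) (x : V), f (ρ g x) = σ g (f x))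
    (hV : SemiFinite ρ) (hW : SemiFinite σ) :
    SemiFinite (subRep ρ (LinearMap.ker f)
      (by
        intro g x hx
        simp only [LinearMap.mem_ker] at hx ⊢
        rw [hf, hx, map_zero])) ∧
    SemiFinite (subRep σ (LinearMap.range f)
      (by rintro g y ⟨x, rfl⟩; exact ⟨ρ g x, hf g x⟩)) ∧
    SemiFinite (quotRep σ (LinearMap.range f)
      (by rintro g y ⟨x, rfl⟩; exact ⟨ρ g x, hf g x⟩)) := by
  refine ⟨hV.of_injective (Submodule.subtype _) (fun _ _ => rfl) (Submodule.subtype_injective _),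
    hW.of_injective (Submodule.subtype _) (fun _ _ => rfl) (Submodule.subtype_injective _),
    hW.of_surjective (Submodule.mkQ _) (fun _ _ => rfl) (Submodule.mkQ_surjective _)⟩
end

section
/- If V and W are finite-dimensional complex representations of a group π, each admitting a filtration by subrepresentations whose successive quotients have finite image, then the tensor product representation V ⊗ W admits such a filtration. -/
open scoped TensorProduct

section Helpers

variable {π : Type} [Group π] {V W : Type}
  [AddCommGroup V] [Module ℂ V] [AddCommGroup W] [Module ℂ W]

/-- Finite image is the same as triviality on a finite index subgroup. -/
theorem hasFiniteImage_iff (τ : Representation ℂ π V) :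
    HasFiniteImage τ ↔ ∃ K : Subgroup π, K.FiniteIndex ∧ ∀ g ∈ K, τ g = 1 := by
  constructor
  · intro h
    have hfin : Finite (Set.range τ) := h
    refine ⟨MonoidHom.ker τ, ?_, fun g hg => hg⟩
    have key : ∀ a b : π, τ a = τ b → a⁻¹ * b ∈ MonoidHom.ker τ := by
      intro a b hab
      rw [MonoidHom.mem_ker, map_mul, ← hab, ← map_mul]
      simp
    have : Finite (π ⧸ MonoidHom.ker τ) := by
      refine Finite.of_injective
        (fun q : π ⧸ MonoidHom.ker τ => (⟨τ q.out, q.out, rfl⟩ : Set.range τ)) ?_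
      intro a b hab
      have h1 : τ a.out = τ b.out := congrArg Subtype.val hab
      have h2 := QuotientGroup.eq.2 (key _ _ h1)
      simpa using h2
    exact Subgroup.finiteIndex_of_finite_quotient
  · rintro ⟨K, hK, h⟩
    have : Finite (π ⧸ K) := inferInstance
    refine (Set.finite_range (fun q : π ⧸ K => τ q.out)).subset ?_
    rintro _ ⟨g, rfl⟩
    refine ⟨(g : π ⧸ K), ?_⟩
    have h1 : (((g : π ⧸ K).out : π) : π ⧸ K) = (g : π ⧸ K) := by simp
    have h2 := h _ (QuotientGroup.eq.1 h1)
    have h3 : τ g = τ (g : π ⧸ K).out * τ ((g : π ⧸ K).out⁻¹ * g) := by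
      rw [← map_mul]; simp
    rw [h3, h2, mul_one]

theorem gradedRep_eq_one_iff (ρ : Representation ℂ π V) (p q : Submodule ℂ V)
    (hp : IsSubrep ρ p) (hq : IsSubrep ρ q) (g : π) :
    gradedRep ρ p q hp hq g = 1 ↔ ∀ x ∈ p, ρ g x - x ∈ q := by
  constructor
  · intro h x hx
    have h1 := LinearMap.congr_fun h (Submodule.Quotient.mk ⟨x, hx⟩)
    have h2 := (Submodule.Quotient.eq _).1 h1
    exact h2
  · intro h
    apply Submodule.linearMap_qext
    ext x
    exact (Submodule.Quotient.eq _).2 (h x.1 x.2)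

theorem SemiFinite.exists_chain {ρ : Representation ℂ π V} (h : SemiFinite ρ) :
    ∃ (K : Subgroup π) (E : ℕ → Submodule ℂ V) (N : ℕ), K.FiniteIndex ∧
      (∀ i, IsSubrep ρ (E i)) ∧ E 0 = ⊤ ∧ (∀ i, N ≤ i → E i = ⊥) ∧
      ∀ i, ∀ g ∈ K, ∀ x ∈ E i, ρ g x - x ∈ E (i + 1) := by
  obtain ⟨n, F, hF, h0, hl, -, hg⟩ := h
  choose K hK hKg using fun i => (hasFiniteImage_iff _).1 (hg i)
  have hbot : ∀ i, n + 1 ≤ i →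
      (if h : i < n + 2 then F ⟨i, h⟩ else ⊥ : Submodule ℂ V) = ⊥ := by
    intro i hi
    split_ifs with h
    · have : i = n + 1 := by omega
      subst this
      exact hl
    · rfl
  refine ⟨⨅ i, K i, fun i => if h : i < n + 2 then F ⟨i, h⟩ else ⊥, n + 1,
    Subgroup.finiteIndex_iInf hK, ?_, ?_, hbot, ?_⟩
  · intro i
    dsimp only
    split_ifs with h
    · exact hF _
    · intro g x hx
      rw [Submodule.mem_bot] at hx ⊢
      simp [hx]
  · simpa using h0
  · intro i g hgK x hx
    by_cases hi : i < n + 1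
    · have h1 := (gradedRep_eq_one_iff _ _ _ _ _ g).1
        (hKg ⟨i, hi⟩ g (Subgroup.mem_iInf.1 hgK _)) x
      have a : i < n + 2 := by omega
      have b : i + 1 < n + 2 := by omega
      simp only [a, b, dif_pos] at hx ⊢
      exact h1 hx
    · have := hbot i (by omega)
      dsimp only at hx
      rw [this, Submodule.mem_bot] at hx
      simp [hx]

theorem semiFinite_of_chain {ρ : Representation ℂ π V} (K : Subgroup π)
    (E : ℕ → Submodule ℂ V) (N : ℕ) (hK : K.FiniteIndex)
    (hE : ∀ i, IsSubrep ρ (E i)) (h0 : E 0 = ⊤) (hN : ∀ i, N ≤ i → E i = ⊥)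
    (hle : ∀ i, E (i + 1) ≤ E i)
    (h : ∀ i, ∀ g ∈ K, ∀ x ∈ E i, ρ g x - x ∈ E (i + 1)) : SemiFinite ρ := by
  refine ⟨N, fun i => E i, fun i => hE i, h0, hN _ (by simp), fun i => hle i, fun i => ?_⟩
  rw [hasFiniteImage_iff]
  exact ⟨K, hK, fun g hg => (gradedRep_eq_one_iff _ _ _ _ _ g).2 (h i g hg)⟩

/-- The convolution filtration on the tensor product. -/
def tensorFil (E : ℕ → Submodule ℂ V) (F : ℕ → Submodule ℂ W) (m : ℕ) :
    Submodule ℂ (V ⊗[ℂ] W) :=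
  Submodule.span ℂ {t | ∃ i j x y, m ≤ i + j ∧ x ∈ E i ∧ y ∈ F j ∧ x ⊗ₜ[ℂ] y = t}

theorem tmul_mem_tensorFil {E : ℕ → Submodule ℂ V} {F : ℕ → Submodule ℂ W} {m : ℕ}
    (i j : ℕ) {x : V} {y : W} (hm : m ≤ i + j) (hx : x ∈ E i) (hy : y ∈ F j) :
    x ⊗ₜ[ℂ] y ∈ tensorFil E F m :=
  Submodule.subset_span ⟨i, j, x, y, hm, hx, hy, rfl⟩

end Helpers

/-- The tensor product of two semi-finite representations is semi-finite. -/
theorem stmt_5 {π V W : Type} [Group π] [AddCommGroup V] [Module ℂ V]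
    [AddCommGroup W] [Module ℂ W] [FiniteDimensional ℂ V] [FiniteDimensional ℂ W]
    (ρ : Representation ℂ π V) (σ : Representation ℂ π W)
    (hV : SemiFinite ρ) (hW : SemiFinite σ) : SemiFinite (ρ.tprod σ) := by
  obtain ⟨K, E, M, hK, hE, hE0, hEM, hEK⟩ := hV.exists_chain
  obtain ⟨L, F, N, hL, hF, hF0, hFN, hFL⟩ := hW.exists_chain
  refine semiFinite_of_chain (K ⊓ L) (tensorFil E F) (M + N) inferInstance ?_ ?_ ?_ ?_ ?_
  · intro m g t ht
    refine Submodule.span_induction (p := fun t _ => (ρ.tprod σ) g t ∈ tensorFil E F m)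
      ?_ ?_ ?_ ?_ ht
    · rintro _ ⟨i, j, x, y, hm, hx, hy, rfl⟩
      exact tmul_mem_tensorFil i j hm (hE i g x hx) (hF j g y hy)
    · simp
    · intro a b _ _ ha hb
      rw [map_add]
      exact add_mem ha hb
    · intro c a _ ha
      rw [map_smul]
      exact Submodule.smul_mem _ c ha
  · rw [eq_top_iff, ← TensorProduct.span_tmul_eq_top]
    refine Submodule.span_le.2 ?_
    rintro _ ⟨x, y, rfl⟩
    exact tmul_mem_tensorFil 0 0 le_rfl (by simp [hE0]) (by simp [hF0])
  · intro m hm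
    rw [eq_bot_iff]
    refine Submodule.span_le.2 ?_
    rintro _ ⟨i, j, x, y, hij, hx, hy, rfl⟩
    rcases (by omega : M ≤ i ∨ N ≤ j) with h | h
    · rw [hEM i h, Submodule.mem_bot] at hx
      simp [hx]
    · rw [hFN j h, Submodule.mem_bot] at hy
      simp [hy]
  · intro m
    refine Submodule.span_le.2 ?_
    rintro _ ⟨i, j, x, y, hij, hx, hy, rfl⟩
    exact tmul_mem_tensorFil i j (by omega) hx hy
  · intro m g hg t ht
    refine Submodule.span_induction
      (p := fun t _ => (ρ.tprod σ) g t - t ∈ tensorFil E F (m + 1)) ?_ ?_ ?_ ?_ ht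
    · rintro _ ⟨i, j, x, y, hm, hx, hy, rfl⟩
      have key : (ρ.tprod σ) g (x ⊗ₜ[ℂ] y) - x ⊗ₜ[ℂ] y
          = (ρ g x - x) ⊗ₜ[ℂ] (σ g y) + x ⊗ₜ[ℂ] (σ g y - y) := by
        rw [TensorProduct.sub_tmul, TensorProduct.tmul_sub]
        change (ρ g x) ⊗ₜ[ℂ] (σ g y) - x ⊗ₜ[ℂ] y = _
        abel
      rw [key]
      exact add_mem
        (tmul_mem_tensorFil (i + 1) j (by omega) (hEK i g hg.1 x hx) (hF j g y hy))
        (tmul_mem_tensorFil i (j + 1) (by omega) hx (hFL j g hg.2 y hy))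
    · simp
    · intro a b _ _ ha hb
      rw [map_add, add_sub_add_comm]
      exact add_mem ha hb
    · intro c a _ ha
      rw [map_smul, ← smul_sub]
      exact Submodule.smul_mem _ c ha
end

section
/- Let π be a group and let 𝒞 be the full subcategory of finite-dimensional complex representations of π consisting of representations admitting a filtration by subrepresentations with successive quotients of finite image. Then 𝒞 contains the trivial one-dimensional representation, and is closed under direct sums, tensor products, duals, subobjects and quotients. -/
open scoped TensorProduct

section Helpers

variable {π : Type} [Group π] {V W : Type}
  [AddCommGroup V] [Module ℂ V] [AddCommGroup W] [Module ℂ W]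

/-- Ascending filtration: iterated `N`-invariants. -/
def lev (N : Subgroup π) (ρ : Representation ℂ π V) : ℕ → Submodule ℂ V
  | 0 => ⊥
  | k + 1 => ⨅ h : N, (lev N ρ k).comap (ρ h - 1)

theorem mem_lev_zero (N : Subgroup π) (ρ : Representation ℂ π V) (x : V) :
    x ∈ lev N ρ 0 ↔ x = 0 := by simp [lev]

theorem mem_lev_succ (N : Subgroup π) (ρ : Representation ℂ π V) (k : ℕ) (x : V) :
    x ∈ lev N ρ (k + 1) ↔ ∀ h ∈ N, ρ h x - x ∈ lev N ρ k := by simp [lev]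

theorem lev_inv (N : Subgroup π) [N.Normal] (ρ : Representation ℂ π V) (k : ℕ) :
    IsSubrep ρ (lev N ρ k) := by
  induction k with
  | zero => intro g x hx; rw [mem_lev_zero] at *; simp [hx]
  | succ k ih =>
    intro g x hx
    rw [mem_lev_succ] at *
    intro h hh
    have h1 := ih g _ (hx (g⁻¹ * h * g) (by
      simpa using (inferInstance : N.Normal).conj_mem h hh g⁻¹))
    have h2 : ρ g (ρ (g⁻¹ * h * g) x) = ρ h (ρ g x) := by
      rw [← Module.End.mul_apply, ← Module.End.mul_apply, ← map_mul, ← map_mul]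
      congr 2; group
    rwa [map_sub, h2] at h1

theorem lev_succ_le (N : Subgroup π) (ρ : Representation ℂ π V) (k : ℕ) :
    lev N ρ k ≤ lev N ρ (k + 1) := by
  induction k with
  | zero => simp [lev]
  | succ k ih =>
    intro x hx
    rw [mem_lev_succ] at *
    exact fun h hh => ih (hx h hh)

theorem lev_mono (N : Subgroup π) (ρ : Representation ℂ π V) : Monotone (lev N ρ) :=
  monotone_nat_of_le_succ (lev_succ_le N ρ)

theorem lev_anti {N M : Subgroup π} (hMN : M ≤ N) (ρ : Representation ℂ π V) (k : ℕ) :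
    lev N ρ k ≤ lev M ρ k := by
  induction k with
  | zero => simp [lev]
  | succ k ih =>
    intro x hx
    rw [mem_lev_succ] at *
    exact fun h hh => ih (hx h (hMN hh))

theorem lev_map (N : Subgroup π) (ρ : Representation ℂ π V) (σ : Representation ℂ π W)
    (f : V →ₗ[ℂ] W) (hf : ∀ g x, f (ρ g x) = σ g (f x)) (k : ℕ) :
    ∀ x ∈ lev N ρ k, f x ∈ lev N σ k := by
  induction k with
  | zero => intro x hx; rw [mem_lev_zero] at *; simp [hx]
  | succ k ih =>
    intro x hx
    rw [mem_lev_succ] at *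
    intro h hh
    rw [← hf, ← map_sub]
    exact ih _ (hx h hh)

theorem lev_comap (N : Subgroup π) (ρ : Representation ℂ π V) (σ : Representation ℂ π W)
    (f : V →ₗ[ℂ] W) (hf : ∀ g x, f (ρ g x) = σ g (f x)) (hi : Function.Injective f) (k : ℕ) :
    ∀ x, f x ∈ lev N σ k → x ∈ lev N ρ k := by
  induction k with
  | zero => intro x hx; rw [mem_lev_zero] at *; exact hi (by simpa using hx)
  | succ k ih =>
    intro x hx
    rw [mem_lev_succ] at *
    intro h hh
    apply ih
    rw [map_sub, hf]
    exact hx h hh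

theorem lev_dual (N : Subgroup π) (ρ : Representation ℂ π V) (k : ℕ) (hk : lev N ρ k = ⊤)
    (i : ℕ) : ∀ (j : ℕ) (φ : Module.Dual ℂ V), i + j = k → (∀ x ∈ lev N ρ j, φ x = 0) →
      φ ∈ lev N ρ.dual i := by
  induction i with
  | zero =>
    intro j φ hj h0
    rw [mem_lev_zero]
    ext x
    apply h0
    rw [show j = k by omega, hk]; trivial
  | succ i ih =>
    intro j φ hj h0
    rw [mem_lev_succ]
    intro h hh
    refine ih (j + 1) _ (by omega) ?_
    intro x hx
    rw [mem_lev_succ] at hx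
    have := h0 _ (hx h⁻¹ (N.inv_mem hh))
    rw [map_sub] at this
    exact this

theorem lev_tensor (N : Subgroup π) [N.Normal] (ρ : Representation ℂ π V)
    (σ : Representation ℂ π W) (n : ℕ) :
    ∀ (i j : ℕ) (x : V) (y : W), i + j = n → x ∈ lev N ρ i → y ∈ lev N σ j →
      x ⊗ₜ[ℂ] y ∈ lev N (ρ.tprod σ) n := by
  induction n with
  | zero =>
    intro i j x y hij hx hy
    obtain rfl : i = 0 := by omega
    rw [mem_lev_zero] at hx
    simp [hx]
  | succ n ih =>
    intro i j x y hij hx hy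
    rcases i with _ | i
    · rw [mem_lev_zero] at hx
      simp [hx]
    rcases j with _ | j
    · rw [mem_lev_zero] at hy
      simp [hy]
    rw [mem_lev_succ]
    intro h hh
    have e : (ρ.tprod σ) h (x ⊗ₜ[ℂ] y) - x ⊗ₜ[ℂ] y =
        (ρ h x - x) ⊗ₜ[ℂ] (σ h y) + x ⊗ₜ[ℂ] (σ h y - y) := by
      simp [TensorProduct.sub_tmul, TensorProduct.tmul_sub]
    rw [e]
    exact add_mem
      (ih i (j + 1) _ _ (by omega) ((mem_lev_succ ..).1 hx h hh) (lev_inv N σ (j + 1) h y hy))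
      (ih (i + 1) j _ _ (by omega) hx ((mem_lev_succ ..).1 hy h hh))

theorem finiteImage_ker (ρ : Representation ℂ π V) (h : HasFiniteImage ρ) :
    (MonoidHom.ker ρ).FiniteIndex := by
  have : Finite (Set.range ρ) := h
  have : Finite (π ⧸ MonoidHom.ker ρ) := by
    refine Finite.of_injective (β := Set.range ρ)
      (Quotient.lift (fun g => (⟨ρ g, g, rfl⟩ : Set.range ρ)) ?_) ?_
    · intro a b hab
      have : a⁻¹ * b ∈ MonoidHom.ker ρ := QuotientGroup.leftRel_apply.1 hab
      rw [MonoidHom.mem_ker] at this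
      apply Subtype.ext
      change ρ a = ρ b
      rw [show b = a * (a⁻¹ * b) by group, map_mul, this, mul_one]
    · rintro ⟨a⟩ ⟨b⟩ hab
      have hab : ρ a = ρ b := congrArg Subtype.val hab
      apply Quotient.sound
      apply QuotientGroup.leftRel_apply.2
      rw [MonoidHom.mem_ker, map_mul, ← hab, ← map_mul]
      simp
  exact Subgroup.finiteIndex_of_finite_quotient

theorem finiteImage_of (ρ : Representation ℂ π V) (N : Subgroup π) [N.FiniteIndex]
    (h : ∀ g ∈ N, ρ g = 1) : HasFiniteImage ρ := by
  have : Finite (π ⧸ N) := inferInstance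
  refine (Set.finite_range (fun q : π ⧸ N => ρ q.out)).subset ?_
  rintro _ ⟨g, rfl⟩
  refine ⟨(g : π ⧸ N), ?_⟩
  obtain ⟨n, hn⟩ := QuotientGroup.mk_out_eq_mul N g
  simp only [hn, map_mul, h n n.2, mul_one]

theorem semiFinite_iff (ρ : Representation ℂ π V) :
    SemiFinite ρ ↔ ∃ N : Subgroup π, N.Normal ∧ N.FiniteIndex ∧ ∃ k, lev N ρ k = ⊤ := by
  constructor
  · rintro ⟨n, F, hF, h0, hl, hle, hfin⟩
    refine ⟨⨅ i : Fin (n + 1), MonoidHom.ker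
      (gradedRep ρ (F i.castSucc) (F i.succ) (hF _) (hF _)), ?_, ?_, n + 1, ?_⟩
    · exact Subgroup.normal_iInf_normal fun i => MonoidHom.normal_ker _
    · exact Subgroup.finiteIndex_iInf fun i => finiteImage_ker _ (hfin i)
    · set N := ⨅ i : Fin (n + 1), MonoidHom.ker
        (gradedRep ρ (F i.castSucc) (F i.succ) (hF _) (hF _)) with hN
      have key : ∀ j : Fin (n + 2), F j ≤ lev N ρ (n + 1 - j) := by
        intro j
        induction j using Fin.reverseInduction with
        | last => rw [hl]; exact bot_le
        | cast i ih =>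
          intro x hx
          have e : n + 1 - (i.castSucc : ℕ) = (n + 1 - (i.succ : ℕ)) + 1 := by
            simp; omega
          rw [e, mem_lev_succ]
          intro h hh
          apply ih
          refine (gradedRep_eq_one_iff ρ _ _ (hF _) (hF _) h).1 ?_ x hx
          exact (Subgroup.mem_iInf.1 hh i)
      have := key 0
      rw [h0] at this
      simpa using this
  · rintro ⟨N, hN, hfi, k, hk⟩
    refine ⟨k, fun i => lev N ρ (k + 1 - i), fun i => lev_inv N ρ _, ?_, ?_, ?_, ?_⟩
    · refine top_le_iff.1 (hk ▸ lev_mono N ρ ?_)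
      simp
    · simp [lev]
    · intro i
      apply lev_mono
      simp only [Fin.val_succ, Fin.val_castSucc]; omega
    · intro i
      apply finiteImage_of _ N
      intro g hg
      rw [gradedRep_eq_one_iff]
      intro x hx
      have e : k + 1 - (i.castSucc : ℕ) = (k + 1 - (i.succ : ℕ)) + 1 := by
        simp; omega
      beta_reduce at hx
      rw [e, mem_lev_succ] at hx
      exact hx g hg

theorem semiFinite_pair (ρ : Representation ℂ π V) (σ : Representation ℂ π W)
    (h1 : SemiFinite ρ) (h2 : SemiFinite σ) :
    ∃ N : Subgroup π, N.Normal ∧ N.FiniteIndex ∧ ∃ k, lev N ρ k = ⊤ ∧ lev N σ k = ⊤ := by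
  obtain ⟨N, hN, hf, k, hk⟩ := (semiFinite_iff ρ).1 h1
  obtain ⟨M, hM, hf', l, hl⟩ := (semiFinite_iff σ).1 h2
  refine ⟨N ⊓ M, inferInstance, inferInstance, max k l, ?_, ?_⟩
  · exact top_le_iff.1 (hk ▸ (lev_anti inf_le_left ρ k).trans (lev_mono _ ρ (le_max_left _ _)))
  · exact top_le_iff.1 (hl ▸ (lev_anti inf_le_right σ l).trans (lev_mono _ σ (le_max_right _ _)))

end Helpers

/-- The full subcategory of finite-dimensional complex representations of `π`
admitting a filtration by subrepresentations with finite-image successive quotients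
contains the trivial one-dimensional representation and is closed under direct sums,
tensor products, duals, subobjects and quotients. -/
theorem stmt_9 {π : Type} [Group π] :
    SemiFinite (Representation.trivial ℂ (G := π) (V := ℂ)) ∧
    (∀ (V W : Type) [AddCommGroup V] [Module ℂ V] [AddCommGroup W] [Module ℂ W]
      [FiniteDimensional ℂ V] [FiniteDimensional ℂ W]
      (ρ : Representation ℂ π V) (σ : Representation ℂ π W),
      SemiFinite ρ → SemiFinite σ → SemiFinite (prodRep ρ σ)) ∧
    (∀ (V W : Type) [AddCommGroup V] [Module ℂ V] [AddCommGroup W] [Module ℂ W]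
      [FiniteDimensional ℂ V] [FiniteDimensional ℂ W]
      (ρ : Representation ℂ π V) (σ : Representation ℂ π W),
      SemiFinite ρ → SemiFinite σ → SemiFinite (ρ.tprod σ)) ∧
    (∀ (V : Type) [AddCommGroup V] [Module ℂ V] [FiniteDimensional ℂ V]
      (ρ : Representation ℂ π V), SemiFinite ρ → SemiFinite ρ.dual) ∧
    (∀ (V : Type) [AddCommGroup V] [Module ℂ V] [FiniteDimensional ℂ V]
      (ρ : Representation ℂ π V) (p : Submodule ℂ V) (hp : IsSubrep ρ p),
      SemiFinite ρ → SemiFinite (subRep ρ p hp)) ∧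
    (∀ (V : Type) [AddCommGroup V] [Module ℂ V] [FiniteDimensional ℂ V]
      (ρ : Representation ℂ π V) (p : Submodule ℂ V) (hp : IsSubrep ρ p),
      SemiFinite ρ → SemiFinite (quotRep ρ p hp)) := by
  refine ⟨?_, ?_, ?_, ?_, ?_, ?_⟩
  · rw [semiFinite_iff]
    refine ⟨⊤, inferInstance, inferInstance, 1, ?_⟩
    rw [eq_top_iff]
    intro x _
    rw [mem_lev_succ]
    simp [mem_lev_zero]
  · intro V W _ _ _ _ _ _ ρ σ h1 h2
    obtain ⟨N, hN, hf, k, hk, hl⟩ := semiFinite_pair ρ σ h1 h2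
    refine (semiFinite_iff _).2 ⟨N, hN, hf, k, eq_top_iff.2 ?_⟩
    rintro ⟨x, y⟩ _
    have a := lev_map N ρ (prodRep ρ σ) (LinearMap.inl ℂ V W)
      (fun g x => by simp [prodRep]) k x (hk ▸ trivial)
    have b := lev_map N σ (prodRep ρ σ) (LinearMap.inr ℂ V W)
      (fun g x => by simp [prodRep]) k y (hl ▸ trivial)
    simpa using add_mem a b
  · intro V W _ _ _ _ _ _ ρ σ h1 h2
    obtain ⟨N, hN, hf, k, hk, hl⟩ := semiFinite_pair ρ σ h1 h2
    refine (semiFinite_iff _).2 ⟨N, hN, hf, k + k, eq_top_iff.2 ?_⟩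
    intro z _
    induction z using TensorProduct.induction_on with
    | zero => exact zero_mem _
    | tmul x y => exact lev_tensor N ρ σ _ k k x y rfl (hk ▸ trivial) (hl ▸ trivial)
    | add a b ha hb => exact add_mem (ha trivial) (hb trivial)
  · intro V _ _ _ ρ h
    obtain ⟨N, hN, hf, k, hk⟩ := (semiFinite_iff ρ).1 h
    refine (semiFinite_iff _).2 ⟨N, hN, hf, k, eq_top_iff.2 ?_⟩
    intro φ _
    refine lev_dual N ρ k hk k 0 φ rfl ?_
    intro x hx
    rw [mem_lev_zero] at hx
    simp [hx]
  · intro V _ _ _ ρ p hp h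
    obtain ⟨N, hN, hf, k, hk⟩ := (semiFinite_iff ρ).1 h
    refine (semiFinite_iff _).2 ⟨N, hN, hf, k, eq_top_iff.2 ?_⟩
    intro x _
    exact lev_comap N (subRep ρ p hp) ρ p.subtype (fun g x => rfl) p.subtype_injective k x
      (hk ▸ trivial)
  · intro V _ _ _ ρ p hp h
    obtain ⟨N, hN, hf, k, hk⟩ := (semiFinite_iff ρ).1 h
    refine (semiFinite_iff _).2 ⟨N, hN, hf, k, eq_top_iff.2 ?_⟩
    intro x _
    obtain ⟨y, rfl⟩ := p.mkQ_surjective x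
    exact lev_map N ρ (quotRep ρ p hp) p.mkQ (fun g x => rfl) k y (hk ▸ trivial)
end
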